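/- Let α = (α_1,…,α_M) and μ = (μ_1,…,μ_N) be nonnegative nonincreasing real sequences with M ≤ N, and let β = (β_1,…,β_M) satisfy β_k = sup S_k for all k = 1,…,M, where S_k := {t ∈ ℝ : f_{k;j}(t) ≤ ν_j for all j = 1,…,k}. Then for every k = 1,…,M and j = 1,…,k there exists b_{k;j} ∈ ℝ such that the preimage f_{k;j}^{-1}((−∞, ν_j]) equals the interval (−∞, b_{k;j}]; moreover β_k = min{b_{k;j} : j = 1,…,k}, β is nonincreasing, α_k ≤ β_k for all k, and β is an (α,μ)-completion. -/

import Mathlib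

open Finset

/-- `a 1, …, a M` is a nonnegative nonincreasing sequence. -/
def NonnegNonincrOn (M : ℕ) (a : ℕ → ℝ) : Prop :=
  (∀ m, 1 ≤ m → m ≤ M → 0 ≤ a m) ∧ ∀ m, 1 ≤ m → m < M → a (m + 1) ≤ a m

/-- `lam` is an `(α,μ)`-completion: it is nonnegative nonincreasing, and it is the spectrum
(with multiplicity) of `A + ∑ₙ φₙ φₙ*` for some self-adjoint `A` with spectrum `α` and
vectors `φₙ ∈ ℂ^M` with `‖φₙ‖² = μₙ`. -/
def IsCompletion (M N : ℕ) (α μ lam : ℕ → ℝ) : Prop :=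
  NonnegNonincrOn M lam ∧
  ∃ (A : Matrix (Fin M) (Fin M) ℂ) (hA : A.IsHermitian)
    (φ : Fin N → Fin M → ℂ)
    (hB : (A + ∑ n : Fin N, Matrix.vecMulVec (φ n) (star (φ n))).IsHermitian)
    (σ τ : Equiv.Perm (Fin M)),
      (∀ i : Fin M, hA.eigenvalues i = α ((σ i : ℕ) + 1)) ∧
      (∀ n : Fin N, ∑ i, ‖φ n i‖ ^ 2 = μ ((n : ℕ) + 1)) ∧
      (∀ i : Fin M, hB.eigenvalues i = lam ((τ i : ℕ) + 1))

/-- If `l` interlaces `a` from above, the rational function `∏ (x - l i) / ∏ (x - a i)` has the form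
`1 - ∑ w i / (x - a i)` with nonnegative weights `w i`. -/
lemma exists_weights_of_interlacing (M : ℕ) (a l : ℕ → ℝ) (hal : ∀ i < M, a i ≤ l i)
    (hla : ∀ i m, i < m → m < M → l m ≤ a i) :
    ∃ w : ℕ → ℝ, (∀ i, 0 ≤ w i) ∧ ∀ x : ℂ, (∀ i < M, x - a i ≠ 0) →
      ∏ i ∈ range M, (x - l i) =
        (∏ i ∈ range M, (x - a i)) * (1 - ∑ i ∈ range M, (w i : ℂ) / (x - a i)) := by
  induction M with
  | zero => exact ⟨fun _ => 0, fun _ => le_rfl, by simp⟩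
  | succ M ih =>
    obtain ⟨w, hw, hwx⟩ := ih (fun i hi => hal i (by omega))
      (fun i m him hm => hla i m him (by omega))
    have hconv : ∀ i, ∃ c d : ℝ, 0 ≤ c ∧ 0 ≤ d ∧ c + d = 1 ∧
        (i < M → c * a M + d * a i = l M) := by
      intro i
      by_cases hi : i < M
      · have hseg : l M ∈ segment ℝ (a M) (a i) := by
          rw [segment_eq_Icc ((hal M (by omega)).trans (hla i M hi (by omega)))]
          exact ⟨hal M (by omega), hla i M hi (by omega)⟩
        obtain ⟨c, d, hc, hd, hcd, h⟩ := hseg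
        exact ⟨c, d, hc, hd, hcd, fun _ => by simpa using h⟩
      · exact ⟨1, 0, by simp, by simp, by simp, fun h => absurd h hi⟩
    choose c d hc hd hcd hl using hconv
    refine ⟨fun i => if i < M then c i * w i else (l M - a M) + ∑ i ∈ range M, d i * w i,
      fun i => ?_, fun x hx => ?_⟩
    · dsimp only
      split_ifs
      · exact mul_nonneg (hc i) (hw i)
      · exact add_nonneg (sub_nonneg.2 (hal M (by omega)))
          (sum_nonneg fun i _ => mul_nonneg (hd i) (hw i))
    · have hM : x - a M ≠ 0 := hx M (by omega)
      rw [prod_range_succ, prod_range_succ, hwx x fun i hi => hx i (by omega), sum_range_succ]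
      have hsum : ∑ i ∈ range M,
          (((if i < M then c i * w i else (l M - a M) + ∑ i ∈ range M, d i * w i : ℝ) : ℂ)) /
            (x - a i) = ∑ i ∈ range M, (c i : ℂ) * w i / (x - a i) :=
        sum_congr rfl fun i hi => by rw [if_pos (mem_range.1 hi)]; push_cast; rfl
      have hsplit : (x - l M) * ∑ i ∈ range M, (w i : ℂ) / (x - a i) =
          (x - a M) * ∑ i ∈ range M, (c i : ℂ) * w i / (x - a i) +
            ∑ i ∈ range M, (d i : ℂ) * w i := by
        rw [mul_sum, mul_sum, ← sum_add_distrib]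
        refine sum_congr rfl fun i hi => ?_
        have hi' := mem_range.1 hi
        have hxi := hx i (by omega)
        have h1 : (l M : ℂ) = c i * a M + d i * a i := by exact_mod_cast (hl i hi').symm
        have h2 : (c i : ℂ) + d i = 1 := by exact_mod_cast hcd i
        field_simp
        rw [h1]
        linear_combination (-(x * w i)) * h2
      rw [hsum]
      simp only [lt_irrefl, if_false]
      push_cast
      have hcancel : ((l M : ℂ) - a M + ∑ i ∈ range M, (d i : ℂ) * w i) / (x - a M) * (x - a M) =
          (l M : ℂ) - a M + ∑ i ∈ range M, (d i : ℂ) * w i := div_mul_cancel₀ _ hM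
      linear_combination (∏ i ∈ range M, (x - a i)) * (hcancel - hsplit)

/-- The characteristic polynomial of a rank-one update of a diagonal matrix. -/
lemma eval_charpoly_diagonal_add_vecMulVec {n : Type*} [Fintype n] [DecidableEq n] (a : n → ℂ)
    (v : n → ℂ) (x : ℂ) (hx : ∀ i, x - a i ≠ 0) :
    (Matrix.diagonal a + Matrix.vecMulVec v (star v)).charpoly.eval x =
      (∏ i, (x - a i)) * (1 - ∑ i, ((‖v i‖ ^ 2 : ℝ) : ℂ) / (x - a i)) := by
  have hdiag : Matrix.scalar n x - (Matrix.diagonal a + Matrix.vecMulVec v (star v)) =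
      Matrix.diagonal (fun i => x - a i) +
        Matrix.replicateCol Unit (-v) * Matrix.replicateRow Unit (star v) := by
    ext i j
    rw [← Matrix.vecMulVec_eq]
    by_cases h : i = j
    · subst h
      simp [Matrix.vecMulVec_apply]
      ring
    · simp [Matrix.vecMulVec_apply, h]
  have hdet : IsUnit (Matrix.diagonal fun i => x - a i).det := by
    rw [Matrix.det_diagonal, isUnit_iff_ne_zero]
    exact prod_ne_zero_iff.2 fun i _ => hx i
  have hinv : (Matrix.diagonal fun i => x - a i)⁻¹ = Matrix.diagonal fun i => (x - a i)⁻¹ := by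
    refine Matrix.inv_eq_right_inv ?_
    rw [Matrix.diagonal_mul_diagonal, ← Matrix.diagonal_one]
    congr 1
    ext i
    exact mul_inv_cancel₀ (hx i)
  rw [Matrix.eval_charpoly, hdiag, Matrix.det_add_replicateCol_mul_replicateRow hdet,
    Matrix.det_diagonal, hinv, Matrix.det_unique]
  congr 1
  simp only [Matrix.add_apply, Matrix.one_apply_eq, Matrix.mul_apply, Matrix.replicateRow_apply,
    Matrix.replicateCol_apply, Matrix.diagonal_apply, mul_ite, mul_zero, sum_ite_eq', mem_univ,
    if_true, sub_eq_add_neg (1 : ℂ), ← sum_neg_distrib]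
  congr 1
  refine sum_congr rfl fun i _ => ?_
  have : (star (v i)) * v i = ((‖v i‖ ^ 2 : ℝ) : ℂ) := by
    push_cast
    exact Complex.conj_mul' (v i)
  rw [← this]
  simp only [Pi.neg_apply, Pi.star_apply]
  ring

open Polynomial in
/-- A Hermitian matrix with prescribed characteristic polynomial has the prescribed spectrum. -/
lemma Matrix.IsHermitian.exists_perm_eigenvalues {n : Type*} [Fintype n] [DecidableEq n]
    {A : Matrix n n ℂ} (hA : A.IsHermitian) (a : n → ℝ)
    (h : A.charpoly = ∏ i, (X - C (a i : ℂ))) :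
    ∃ σ : Equiv.Perm n, ∀ i, hA.eigenvalues i = a (σ i) := by
  have hroots := hA.roots_charpoly_eq_eigenvalues
  rw [h, Polynomial.roots_prod _ _
    (by simp [Finset.prod_ne_zero_iff, Polynomial.X_sub_C_ne_zero])] at hroots
  have hroots' : Multiset.map hA.eigenvalues univ.val = Multiset.map a univ.val := by
    have := congrArg (Multiset.map Complex.re) hroots
    simpa [Multiset.map_map, Function.comp_def] using this.symm
  have hcard : ∀ c : ℝ, Fintype.card {i // hA.eigenvalues i = c} = Fintype.card {i // a i = c} := by
    intro c
    have := congrArg (Multiset.count c) hroots'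
    rw [Multiset.count_map, Multiset.count_map] at this
    rw [Fintype.card_subtype, Fintype.card_subtype]
    simpa [Finset.card, eq_comm] using this
  exact ⟨Equiv.ofFiberEquiv fun c => Fintype.equivOfCardEq (hcard c),
    fun i => (Equiv.ofFiberEquiv_map _ i).symm⟩

lemma Matrix.isHermitian_vecMulVec_star {n : Type*} (v : n → ℂ) :
    (Matrix.vecMulVec v (star v)).IsHermitian := by
  ext i j
  simp [Matrix.vecMulVec_apply, mul_comm]

lemma Matrix.trace_vecMulVec_star {n : Type*} [Fintype n] (v : n → ℂ) :
    (Matrix.vecMulVec v (star v)).trace = ((∑ i, ‖v i‖ ^ 2 : ℝ) : ℂ) := by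
  simp [Matrix.trace, Matrix.vecMulVec_apply, Complex.mul_conj']

open Polynomial in
lemma Matrix.trace_eq_sum_of_charpoly {n : Type*} [Fintype n] [DecidableEq n]
    {A : Matrix n n ℂ} (a : n → ℝ) (h : A.charpoly = ∏ i, (X - C (a i : ℂ))) :
    A.trace = ((∑ i, a i : ℝ) : ℂ) := by
  rw [Matrix.trace_eq_sum_roots_charpoly, h, Polynomial.roots_prod _ _
    (by simp [Finset.prod_ne_zero_iff, Polynomial.X_sub_C_ne_zero])]
  simp

open Polynomial in
/-- Converse of Weyl interlacing: every interlacing spectrum is attained by a rank-one update. -/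
lemma exists_rank_one_update (M : ℕ) (a l : ℕ → ℝ) (hal : ∀ i < M, a i ≤ l i)
    (hla : ∀ i m, i < m → m < M → l m ≤ a i) {A : Matrix (Fin M) (Fin M) ℂ} (hA : A.IsHermitian)
    (hchar : A.charpoly = ∏ i : Fin M, (X - C (a i : ℂ))) :
    ∃ v : Fin M → ℂ,
      (A + Matrix.vecMulVec v (star v)).charpoly = ∏ i : Fin M, (X - C (l i : ℂ)) ∧
      ∑ i, ‖v i‖ ^ 2 = ∑ i ∈ range M, (l i - a i) := by
  obtain ⟨w, hw, hwx⟩ := exists_weights_of_interlacing M a l hal hla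
  obtain ⟨σ, hσ⟩ := hA.exists_perm_eigenvalues (fun i : Fin M => a i) hchar
  set u : Fin M → ℂ := fun i => (Real.sqrt (w (σ i)) : ℂ) with hu
  have hunorm : ∀ i, ‖u i‖ ^ 2 = w (σ i) := fun i => by
    simp [hu, Complex.norm_real, Real.sq_sqrt (hw _)]
  set U : Matrix (Fin M) (Fin M) ℂ := ↑hA.eigenvectorUnitary
  set D : Matrix (Fin M) (Fin M) ℂ := Matrix.diagonal (fun i => ((a (σ i) : ℝ) : ℂ)) with hD
  have hUU : star U * U = 1 := Unitary.coe_star_mul_self hA.eigenvectorUnitary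
  have hAD : A = U * D * star U := by
    conv_lhs => rw [hA.spectral_theorem, Unitary.conjStarAlgAut_apply]
    rw [hD]
    congr 3
    ext i
    simp [hσ]
  have hup : A + Matrix.vecMulVec (U.mulVec u) (star (U.mulVec u)) =
      U * ((D + Matrix.vecMulVec u (star u)) * star U) := by
    conv_lhs => rw [hAD]
    rw [Matrix.star_mulVec, ← Matrix.mul_vecMulVec, ← Matrix.vecMulVec_mul, add_mul, mul_add,
      Matrix.star_eq_conjTranspose]
    simp only [Matrix.mul_assoc]
  have hcp : (A + Matrix.vecMulVec (U.mulVec u) (star (U.mulVec u))).charpoly =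
      ∏ i : Fin M, (X - C (l i : ℂ)) := by
    rw [hup, Matrix.charpoly_mul_comm, Matrix.mul_assoc, hUU, Matrix.mul_one]
    refine Polynomial.eq_of_infinite_eval_eq _ _ (Set.Infinite.mono ?_
      (Set.Finite.infinite_compl (Set.finite_range fun i : Fin M => (a i : ℂ))))
    intro x hx
    have hx' : ∀ i (hi : i < M), x - a i ≠ 0 := fun i hi h =>
      hx ⟨⟨i, hi⟩, (sub_eq_zero.1 h).symm⟩
    rw [Set.mem_ofPred_eq, eval_charpoly_diagonal_add_vecMulVec _ _ _ fun i => hx' _ (σ i).2,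
      Polynomial.eval_prod]
    simp only [hunorm, eval_sub, eval_X, eval_C]
    rw [Equiv.prod_comp σ (fun i : Fin M => x - (a i : ℂ)),
      Equiv.sum_comp σ (fun i : Fin M => (w i : ℂ) / (x - (a i : ℂ))),
      Fin.prod_univ_eq_prod_range (fun i => x - (a i : ℂ)),
      Fin.prod_univ_eq_prod_range (fun i => x - (l i : ℂ)),
      Fin.sum_univ_eq_sum_range (fun i => (w i : ℂ) / (x - (a i : ℂ)))]
    exact (hwx x hx').symm
  refine ⟨U.mulVec u, hcp, ?_⟩
  have htr := Matrix.trace_eq_sum_of_charpoly (fun i : Fin M => l i) hcp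
  rw [Matrix.trace_add, Matrix.trace_eq_sum_of_charpoly (fun i : Fin M => a i) hchar,
    Matrix.trace_vecMulVec_star, ← Complex.ofReal_add, Complex.ofReal_inj,
    Fin.sum_univ_eq_sum_range a, Fin.sum_univ_eq_sum_range l] at htr
  rw [sum_sub_distrib]
  linarith

open Polynomial in
/-- A chain of interlacing spectra is realized by successive rank-one updates. -/
lemma exists_updates_of_chain (M n : ℕ) (s : ℕ → ℕ → ℝ)
    (hle : ∀ j, ∀ i < M, s (j + 1) i ≤ s j i)
    (hge : ∀ j i m, i < m → m < M → s j m ≤ s (j + 1) i) :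
    ∃ φ : ℕ → Fin M → ℂ,
      (Matrix.diagonal (fun i : Fin M => (s n i : ℂ)) +
        ∑ k ∈ range n, Matrix.vecMulVec (φ k) (star (φ k))).charpoly =
          ∏ i : Fin M, (X - C (s 0 i : ℂ)) ∧
      ∀ k < n, ∑ i, ‖φ k i‖ ^ 2 = ∑ i ∈ range M, (s k i - s (k + 1) i) := by
  induction n generalizing s with
  | zero => exact ⟨fun _ => 0, by simp [Matrix.charpoly_diagonal], by simp⟩
  | succ n ih =>
    obtain ⟨φ, hφ, hnorm⟩ := ih (fun j => s (j + 1)) (fun j => hle (j + 1)) (fun j => hge (j + 1))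
    have hherm : (Matrix.diagonal (fun i : Fin M => (s (n + 1) i : ℂ)) +
        ∑ k ∈ range n, Matrix.vecMulVec (φ k) (star (φ k))).IsHermitian := by
      refine Matrix.IsHermitian.add ?_ ?_
      · exact Matrix.isHermitian_diagonal_of_self_adjoint _ (by ext i; simp)
      · exact isSelfAdjoint_sum _ fun k _ => Matrix.isHermitian_vecMulVec_star (φ k)
    obtain ⟨v, hv, hvn⟩ := exists_rank_one_update M (s 1) (s 0) (hle 0) (hge 0) hherm hφ
    refine ⟨fun k => Nat.casesOn k v φ, ?_, ?_⟩
    · rw [sum_range_succ', ← add_assoc]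
      exact hv
    · rintro (_ | k) hk
      · exact hvn
      · exact hnorm k (by omega)

/-- Two vectors can be rotated so that the first squared norm takes any intermediate value, without
changing the sum of the two rank-one matrices. -/
lemma exists_rotation {n : Type*} [Fintype n] (φ ψ : n → ℂ) (z : ℝ)
    (hz : z ∈ Set.Icc (∑ i, ‖ψ i‖ ^ 2) (∑ i, ‖φ i‖ ^ 2)) :
    ∃ φ' ψ' : n → ℂ,
      Matrix.vecMulVec φ' (star φ') + Matrix.vecMulVec ψ' (star ψ') =
        Matrix.vecMulVec φ (star φ) + Matrix.vecMulVec ψ (star ψ) ∧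
      ∑ i, ‖φ' i‖ ^ 2 = z ∧
      ∑ i, ‖ψ' i‖ ^ 2 = ∑ i, ‖φ i‖ ^ 2 + ∑ i, ‖ψ i‖ ^ 2 - z := by
  have hcont : Continuous fun θ : ℝ =>
      ∑ i, ‖(Real.cos θ : ℂ) * φ i + (Real.sin θ : ℂ) * ψ i‖ ^ 2 := by
    fun_prop
  obtain ⟨θ, -, hθ⟩ := intermediate_value_Icc' Real.pi_div_two_pos.le hcont.continuousOn
    (by simpa using hz)
  set c := Real.cos θ
  set s := Real.sin θ
  have hcs : (c : ℂ) ^ 2 + (s : ℂ) ^ 2 = 1 := by exact_mod_cast Real.cos_sq_add_sin_sq θ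
  have hmat : Matrix.vecMulVec (fun i => (c : ℂ) * φ i + (s : ℂ) * ψ i)
        (star fun i => (c : ℂ) * φ i + (s : ℂ) * ψ i) +
      Matrix.vecMulVec (fun i => -(s : ℂ) * φ i + (c : ℂ) * ψ i)
        (star fun i => -(s : ℂ) * φ i + (c : ℂ) * ψ i) =
      Matrix.vecMulVec φ (star φ) + Matrix.vecMulVec ψ (star ψ) := by
    ext i j
    simp only [Matrix.add_apply, Matrix.vecMulVec_apply, Pi.star_apply, star_add, star_mul',
      star_neg, Complex.star_def, Complex.conj_ofReal]
    linear_combination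
      (φ i * (starRingEnd ℂ) (φ j) + ψ i * (starRingEnd ℂ) (ψ j)) * hcs
  refine ⟨_, _, hmat, hθ, ?_⟩
  have htr := congrArg Matrix.trace hmat
  simp only [Matrix.trace_add, Matrix.trace_vecMulVec_star, ← Complex.ofReal_add,
    Complex.ofReal_inj] at htr
  dsimp only at hθ
  linarith

/-- A property of sequences that is stable under transfers from a larger to a smaller entry passes
from `b` to every nonincreasing sequence whose partial sums are dominated by those of `b`. -/
lemma exists_of_transfers {N : ℕ} (P : (ℕ → ℝ) → Prop)
    (hP : ∀ b i j δ, i < j → j < N → 0 ≤ δ → b j + δ ≤ b i → P b →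
      P fun m => b m - (if m = i then δ else 0) + (if m = j then δ else 0))
    (μ : ℕ → ℝ) (hμ : ∀ i j, i ≤ j → j < N → μ j ≤ μ i) (b : ℕ → ℝ) (hb : P b)
    (hle : ∀ n ≤ N, ∑ m ∈ range n, μ m ≤ ∑ m ∈ range n, b m)
    (heq : ∑ m ∈ range N, b m = ∑ m ∈ range N, μ m) :
    ∃ b', P b' ∧ ∀ m < N, b' m = μ m := by
  induction hd : #{m ∈ range N | b m ≠ μ m} using Nat.strong_induction_on generalizing b with
  | _ d ih =>
  by_cases hall : ∀ m < N, μ m ≤ b m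
  · exact ⟨b, hb, fun m hm => ((sum_eq_sum_iff_of_le fun m hm => hall m (mem_range.1 hm)).1
      heq.symm m (mem_range.2 hm)).symm⟩
  push Not at hall
  classical
  obtain ⟨hjN, hjlt⟩ := Nat.find_spec hall
  have hjmin : ∀ m < Nat.find hall, μ m ≤ b m := fun m hm => by
    have := Nat.find_min hall hm
    push Not at this
    exact this (hm.trans hjN)
  generalize Nat.find hall = j at hjN hjlt hjmin
  obtain ⟨i, hij, hilt⟩ : ∃ i < j, μ i < b i := by
    have hj := hle (j + 1) hjN
    rw [sum_range_succ, sum_range_succ] at hj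
    obtain ⟨i, hi, h⟩ := exists_lt_of_sum_lt (s := range j) (f := μ) (g := b) (by linarith)
    exact ⟨i, mem_range.1 hi, h⟩
  have hμij := hμ i j hij.le hjN
  obtain ⟨δ, hδ⟩ : ∃ δ, δ = min (b i - μ i) (μ j - b j) := ⟨_, rfl⟩
  have hδ0 : 0 ≤ δ := hδ ▸ le_min (by linarith) (by linarith)
  have hδi : δ ≤ b i - μ i := hδ ▸ min_le_left _ _
  have hδj : δ ≤ μ j - b j := hδ ▸ min_le_right _ _
  set b₁ : ℕ → ℝ := fun m => b m - (if m = i then δ else 0) + (if m = j then δ else 0) with hb₁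
  have hb₁i : b₁ i = b i - δ := by simp [hb₁, hij.ne]
  have hb₁j : b₁ j = b j + δ := by simp [hb₁, hij.ne']
  have hb₁m : ∀ m, m ≠ i → m ≠ j → b₁ m = b m := fun m hi hj => by simp [hb₁, hi, hj]
  have hsum : ∀ n, ∑ m ∈ range n, b₁ m =
      ∑ m ∈ range n, b m - (if i < n then δ else 0) + (if j < n then δ else 0) := fun n => by
    simp [hb₁, sum_add_distrib, sum_sub_distrib]
  refine ih _ ?_ b₁ (hP b i j δ hij hjN hδ0 (by linarith) hb) ?_ ?_ rfl
  · rw [← hd]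
    refine card_lt_card ((ssubset_iff_of_subset ?_).2 ?_)
    · intro m hm
      simp only [mem_filter, mem_range] at hm ⊢
      refine ⟨hm.1, ?_⟩
      by_cases hmi : m = i
      · rw [hmi]; exact hilt.ne'
      by_cases hmj : m = j
      · rw [hmj]; exact hjlt.ne
      rw [← hb₁m m hmi hmj]
      exact hm.2
    · rcases min_choice (b i - μ i) (μ j - b j) with h | h
      · refine ⟨i, by simp [hilt.ne', hij.trans hjN], ?_⟩
        simp [hb₁i, hδ, h]
      · refine ⟨j, by simp [hjlt.ne, hjN], ?_⟩
        simp [hb₁j, hδ, h]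
  · intro n hn
    rw [hsum]
    by_cases hjn : j < n
    · rw [if_pos hjn, if_pos (hij.trans hjn)]
      linarith [hle n hn]
    rw [if_neg hjn]
    by_cases hin : i < n
    · rw [if_pos hin]
      have := single_le_sum (s := range n) (f := fun m => b m - μ m)
        (fun m hm => sub_nonneg.2 (hjmin m (by have := mem_range.1 hm; omega))) (mem_range.2 hin)
      rw [sum_sub_distrib] at this
      linarith
    · rw [if_neg hin]
      linarith [hle n hn]
  · rw [hsum, if_pos hjN, if_pos (hij.trans hjN), ← heq]
    ring

/-- Vectors with squared norms `b` can be replaced by vectors with squared norms `μ` and the same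
frame operator, when `μ` is nonincreasing and majorized by `b`. -/
lemma exists_frame_of_majorized {n : Type*} [Fintype n] {N : ℕ} (φ : ℕ → n → ℂ) (μ b : ℕ → ℝ)
    (hφ : ∀ m < N, ∑ i, ‖φ m i‖ ^ 2 = b m) (hμ : ∀ i j, i ≤ j → j < N → μ j ≤ μ i)
    (hle : ∀ p ≤ N, ∑ m ∈ range p, μ m ≤ ∑ m ∈ range p, b m)
    (heq : ∑ m ∈ range N, b m = ∑ m ∈ range N, μ m) :
    ∃ ψ : ℕ → n → ℂ, (∀ m < N, ∑ i, ‖ψ m i‖ ^ 2 = μ m) ∧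
      ∑ m ∈ range N, Matrix.vecMulVec (ψ m) (star (ψ m)) =
        ∑ m ∈ range N, Matrix.vecMulVec (φ m) (star (φ m)) := by
  let P : (ℕ → ℝ) → Prop := fun b => ∃ ψ : ℕ → n → ℂ, (∀ m < N, ∑ i, ‖ψ m i‖ ^ 2 = b m) ∧
    ∑ m ∈ range N, Matrix.vecMulVec (ψ m) (star (ψ m)) =
      ∑ m ∈ range N, Matrix.vecMulVec (φ m) (star (φ m))
  have htransfer : ∃ b', P b' ∧ ∀ m < N, b' m = μ m := by
    refine exists_of_transfers P ?_ μ hμ b ⟨φ, hφ, rfl⟩ hle heq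
    rintro b i j δ hij hjN hδ hbij ⟨ψ, hψ, hsum⟩
    have hiN := hij.trans hjN
    obtain ⟨u, v, huv, hu, hv⟩ := exists_rotation (ψ i) (ψ j) (b i - δ)
      ⟨by rw [hψ j hjN]; linarith, by rw [hψ i hiN]; linarith⟩
    rw [hψ i hiN, hψ j hjN] at hv
    refine ⟨Function.update (Function.update ψ i u) j v, fun m hm => ?_, ?_⟩
    · by_cases hmj : m = j
      · subst hmj
        simp only [Function.update_self, hv, if_true, hij.ne', if_false]
        ring
      by_cases hmi : m = i
      · subst hmi
        simp [hu, hmj]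
      · simp [hmi, hmj, hψ m hm]
    · rw [← hsum, ← add_sum_erase _ _ (mem_range.2 hjN),
        ← add_sum_erase _ _ (mem_erase.2 ⟨hij.ne, mem_range.2 hiN⟩),
        ← add_sum_erase (range N) (fun m => Matrix.vecMulVec (ψ m) (star (ψ m))) (mem_range.2 hjN),
        ← add_sum_erase _ (fun m => Matrix.vecMulVec (ψ m) (star (ψ m)))
          (mem_erase.2 ⟨hij.ne, mem_range.2 hiN⟩), ← add_assoc, ← add_assoc]
      congr 1
      · simp only [Function.update_self, Function.update_of_ne hij.ne]
        rw [add_comm, huv, add_comm]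
      · refine sum_congr rfl fun m hm => ?_
        simp only [mem_erase] at hm
        simp [hm.1, hm.2.1]
  obtain ⟨b', ⟨ψ, hψ, hsum⟩, hb'⟩ := htransfer
  exact ⟨ψ, fun m hm => (hψ m hm).trans (hb' m hm), hsum⟩

lemma NonnegNonincrOn.le_of_le {M : ℕ} {a : ℕ → ℝ} (ha : NonnegNonincrOn M a) {p q : ℕ}
    (hp : 1 ≤ p) (hpq : p ≤ q) (hq : q ≤ M) : a q ≤ a p := by
  induction q, hpq using Nat.le_induction with
  | base => exact le_rfl
  | succ q hpq ih => exact (ha.2 q (by omega) (by omega)).trans (ih (by omega))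

/-- Sufficiency half of the generalized Schur–Horn theorem. -/
lemma isCompletion_of_tail_sums {M N : ℕ} (hMN : M ≤ N) {α μ β : ℕ → ℝ}
    (hα : NonnegNonincrOn M α) (hμ : NonnegNonincrOn N μ) (hβ : NonnegNonincrOn M β)
    (hαβ : ∀ k, 1 ≤ k → k ≤ M → α k ≤ β k)
    (htail : ∀ p < M, ∑ m ∈ Icc (p + 1) M, max (β m - α (m - p)) 0 ≤ ∑ n ∈ Icc (p + 1) N, μ n)
    (htotal : ∑ m ∈ Icc 1 M, max (β m - α m) 0 = ∑ n ∈ Icc 1 N, μ n) :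
    IsCompletion M N α μ β := by
  let β₀ : ℕ → ℝ := fun m => if m ≤ M then β m else 0
  have hβ₀ : ∀ p q, 1 ≤ p → p ≤ q → β₀ q ≤ β₀ p := by
    intro p q hp hpq
    by_cases hq : q ≤ M
    · simpa [β₀, hq, hpq.trans hq] using hβ.le_of_le hp hpq hq
    · by_cases hpM : p ≤ M
      · simpa [β₀, hq, hpM] using hβ.1 p hp hpM
      · simp [β₀, hq, hpM]
  let s : ℕ → ℕ → ℝ := fun j i => max (β₀ (i + 1 + j)) (α (i + 1))
  have hs0 : ∀ i < M, s 0 i = β (i + 1) := fun i hi => by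
    simp [s, β₀, Nat.succ_le_of_lt hi, hαβ (i + 1) (by omega) (by omega)]
  have hsM : ∀ j, M ≤ j → ∀ i < M, s j i = α (i + 1) := fun j hj i hi => by
    have : ¬ i + 1 + j ≤ M := by omega
    simp [s, β₀, this, hα.1 (i + 1) (by omega) (by omega)]
  obtain ⟨φ, hφ, hnorm⟩ := exists_updates_of_chain M N s
    (fun j i hi => max_le_max_right _ (hβ₀ _ _ (by omega) (by omega)))
    (fun j i m him hm => max_le_max (hβ₀ _ _ (by omega) (by omega))
      (hα.le_of_le (by omega) (by omega) (by omega)))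
  have hexcess : ∀ p, ∑ i ∈ range M, (s p i - s N i) =
      ∑ m ∈ Icc (p + 1) M, max (β m - α (m - p)) 0 := by
    intro p
    rw [← Ico_add_one_right_eq_Icc, sum_Ico_eq_sum_range]
    symm
    refine sum_subset_zero_on_sdiff (range_subset_range.2 (by omega)) (fun i hi => ?_)
      (fun i hi => ?_)
    · simp only [mem_sdiff, mem_range] at hi
      have : ¬ i + 1 + p ≤ M := by omega
      rw [hsM N hMN i hi.1]
      simp [s, β₀, this, hα.1 (i + 1) (by omega) (by omega)]
    · have hi := mem_range.1 hi
      have h1 : i + 1 + p ≤ M := by omega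
      rw [hsM N hMN i (by omega), show p + 1 + i - p = i + 1 by omega,
        show p + 1 + i = i + 1 + p by omega]
      simp only [s, β₀, if_pos h1]
      rw [← max_sub_sub_right, sub_self]
  have hprefix : ∀ p, ∑ m ∈ range p, ∑ i ∈ range M, (s m i - s (m + 1) i) =
      ∑ i ∈ range M, (s 0 i - s N i) - ∑ i ∈ range M, (s p i - s N i) := by
    intro p
    rw [sum_comm, ← sum_sub_distrib]
    refine sum_congr rfl fun i _ => ?_
    rw [sum_range_sub' (fun m => s m i)]
    ring
  have hμprefix : ∀ p ≤ N, ∑ m ∈ range p, μ (m + 1) =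
      ∑ n ∈ Icc 1 N, μ n - ∑ n ∈ Icc (p + 1) N, μ n := by
    intro p hp
    rw [← Ico_add_one_right_eq_Icc, ← Ico_add_one_right_eq_Icc, eq_sub_iff_add_eq,
      ← sum_Ico_consecutive μ (show 1 ≤ p + 1 by omega) (show p + 1 ≤ N + 1 by omega),
      sum_Ico_eq_sum_range μ 1 (p + 1)]
    simp [add_comm 1]
  have htotal' : ∑ i ∈ range M, (s 0 i - s N i) = ∑ n ∈ Icc 1 N, μ n := by
    rw [hexcess, ← htotal]
    simp
  obtain ⟨ψ, hψ, hsum⟩ := exists_frame_of_majorized φ (fun m => μ (m + 1)) _ hnorm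
    (fun i j hij hj => hμ.le_of_le (by omega) (by omega) (by omega)) (fun p hp => by
      rw [hμprefix p hp, hprefix, htotal', hexcess]
      refine sub_le_sub_left ?_ _
      by_cases hpM : p < M
      · exact htail p hpM
      · rw [Icc_eq_empty (by omega), sum_empty]
        refine sum_nonneg fun n hn => ?_
        have := mem_Icc.1 hn
        exact hμ.1 n (by omega) (by omega)) (by
      rw [hprefix, hμprefix N le_rfl, htotal']
      simp)
  have hdiag : (Matrix.diagonal fun i : Fin M => (s N i : ℂ)) =
      Matrix.diagonal fun i : Fin M => (α ((i : ℕ) + 1) : ℂ) := by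
    congr 1
    ext i
    rw [hsM N hMN i i.2]
  rw [hdiag, ← hsum, ← Fin.sum_univ_eq_sum_range
    (fun m => Matrix.vecMulVec (ψ m) (star (ψ m)))] at hφ
  have hA : (Matrix.diagonal fun i : Fin M => (α ((i : ℕ) + 1) : ℂ)).IsHermitian :=
    Matrix.isHermitian_diagonal_of_self_adjoint _ (by ext i; simp)
  have hB : (Matrix.diagonal (fun i : Fin M => (α ((i : ℕ) + 1) : ℂ)) +
      ∑ n : Fin N, Matrix.vecMulVec (ψ n) (star (ψ n))).IsHermitian :=
    hA.add (isSelfAdjoint_sum _ fun n _ => Matrix.isHermitian_vecMulVec_star (ψ n))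
  obtain ⟨σ, hσ⟩ := hA.exists_perm_eigenvalues (fun i : Fin M => α ((i : ℕ) + 1))
    (Matrix.charpoly_diagonal _)
  obtain ⟨τ, hτ⟩ := hB.exists_perm_eigenvalues (fun i : Fin M => s 0 i) hφ
  exact ⟨hβ, _, hA, fun n => ψ n, hB, σ, τ, hσ, fun n => hψ n n.2,
    fun i => (hτ i).trans (hs0 _ (τ i).2)⟩

/-- A nonempty sublevel set of a nondecreasing continuous function tending to infinity is a closed
half-line. -/
lemma exists_sublevel_eq_Iic {g : ℝ → ℝ} (hmono : Monotone g) (hcont : Continuous g)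
    (htop : Filter.Tendsto g Filter.atTop Filter.atTop) {c : ℝ} (hne : ∃ t, g t ≤ c) :
    ∃ b, {t | g t ≤ c} = Set.Iic b := by
  obtain ⟨T, hT⟩ := (htop.eventually_gt_atTop c).exists
  have hbdd : BddAbove {t | g t ≤ c} :=
    ⟨T, fun t ht => le_of_not_gt fun h => (hT.trans_le (hmono h.le)).not_ge ht⟩
  have hmem : sSup {t | g t ≤ c} ∈ {t | g t ≤ c} :=
    (isClosed_le hcont continuous_const).csSup_mem hne hbdd
  exact ⟨_, Set.Subset.antisymm (fun t ht => le_csSup hbdd ht)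
    fun t ht => (hmono ht).trans hmem⟩

/-- For the recursively defined sequence `β` (with `β k = sup S k`): each sublevel set
`{t : f k j t ≤ ν j}` is a closed half-line `(-∞, b k j]`, `β k` is the minimum of the
`b k j` over `j = 1, …, k`, `β` is nonincreasing, `α k ≤ β k` for all `k`, and `β` is an
`(α,μ)`-completion. -/
theorem optimal_completion_welldefined (M N : ℕ) (hM : 0 < M) (hMN : M ≤ N)
    (α μ : ℕ → ℝ) (hα : NonnegNonincrOn M α) (hμ : NonnegNonincrOn N μ)
    (β : ℕ → ℝ) (f : ℕ → ℕ → ℝ → ℝ)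
    (hf : ∀ k j (t : ℝ), f k j t =
      ∑ m ∈ Icc j k, max (t - α (m - j + 1)) 0
        + ∑ m ∈ Icc (k + 1) M, max (β m - α (m - j + 1)) 0)
    (ν : ℕ → ℝ) (hν : ∀ j, ν j = ∑ n ∈ Icc j N, μ n)
    (S : ℕ → Set ℝ)
    (hS : ∀ k, S k = {t : ℝ | ∀ j, 1 ≤ j → j ≤ k → f k j t ≤ ν j})
    (hβ : ∀ k, 1 ≤ k → k ≤ M → β k = sSup (S k))
    :
    (∀ k, 1 ≤ k → k ≤ M → ∃ b : ℕ → ℝ,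
      (∀ j, 1 ≤ j → j ≤ k → {t : ℝ | f k j t ≤ ν j} = Set.Iic (b j)) ∧
      (∃ j₀, 1 ≤ j₀ ∧ j₀ ≤ k ∧ β k = b j₀) ∧
      ∀ j, 1 ≤ j → j ≤ k → β k ≤ b j) ∧
    (∀ k, 1 ≤ k → k < M → β (k + 1) ≤ β k) ∧
    (∀ k, 1 ≤ k → k ≤ M → α k ≤ β k) ∧
    IsCompletion M N α μ β := by
  have hmono : ∀ k j, Monotone (f k j) := fun k j x y hxy => by
    rw [hf, hf]
    gcongr
  have hcont : ∀ k j, Continuous (f k j) := fun k j => by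
    rw [funext (hf k j)]
    fun_prop
  have hge : ∀ k j t, 1 ≤ j → j ≤ k → t - α 1 ≤ f k j t := fun k j t hj hjk => by
    rw [hf]
    have h1 := single_le_sum (s := Icc j k) (f := fun m => max (t - α (m - j + 1)) 0)
      (fun m _ => le_max_right _ _) (mem_Icc.2 ⟨le_rfl, hjk⟩)
    have h2 : 0 ≤ ∑ m ∈ Icc (k + 1) M, max (β m - α (m - j + 1)) 0 :=
      sum_nonneg fun m _ => le_max_right _ _
    have h3 := le_max_left (t - α (j - j + 1)) 0
    simp only [Nat.sub_self, zero_add] at h1 h3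
    linarith
  have htop : ∀ k j, 1 ≤ j → j ≤ k → Filter.Tendsto (f k j) Filter.atTop Filter.atTop :=
    fun k j hj hjk => Filter.tendsto_atTop_mono (fun t => hge k j t hj hjk)
      (Filter.tendsto_atTop_add_const_right _ _ Filter.tendsto_id)
  have hνnonneg : ∀ j, 1 ≤ j → 0 ≤ ν j := fun j hj => by
    rw [hν]
    refine sum_nonneg fun n hn => ?_
    have := mem_Icc.1 hn
    exact hμ.1 n (by omega) (by omega)
  have hfα : ∀ k j, 1 ≤ j → k ≤ M →
      f k j (α k) = ∑ m ∈ Icc (k + 1) M, max (β m - α (m - j + 1)) 0 := fun k j hj hk => by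
    rw [hf, add_eq_right]
    refine sum_eq_zero fun m hm => max_eq_right (sub_nonpos.2 ?_)
    have := mem_Icc.1 hm
    exact hα.le_of_le (by omega) (by omega) hk
  have hhalf : ∀ k, 1 ≤ k → k ≤ M → α k ∈ S k → ∃ b : ℕ → ℝ,
      (∀ j, 1 ≤ j → j ≤ k → {t : ℝ | f k j t ≤ ν j} = Set.Iic (b j)) ∧
      (∃ j₀, 1 ≤ j₀ ∧ j₀ ≤ k ∧ β k = b j₀) ∧ ∀ j, 1 ≤ j → j ≤ k → β k ≤ b j := by
    intro k hk hkM hαk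
    rw [hS] at hαk
    have hex : ∀ j, ∃ b, 1 ≤ j → j ≤ k → {t : ℝ | f k j t ≤ ν j} = Set.Iic b := fun j => by
      by_cases hj : 1 ≤ j ∧ j ≤ k
      · obtain ⟨b, hb⟩ := exists_sublevel_eq_Iic (hmono k j) (hcont k j) (htop k j hj.1 hj.2)
          ⟨α k, hαk j hj.1 hj.2⟩
        exact ⟨b, fun _ _ => hb⟩
      · exact ⟨0, fun h1 h2 => absurd ⟨h1, h2⟩ hj⟩
    choose b hb using hex
    obtain ⟨j₀, hj₀, hmin⟩ := exists_min_image (Icc 1 k) b ⟨1, mem_Icc.2 ⟨le_rfl, hk⟩⟩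
    have hj₀' := mem_Icc.1 hj₀
    have hSk : S k = Set.Iic (b j₀) := by
      rw [hS]
      ext t
      have hiff : ∀ j, 1 ≤ j → j ≤ k → (f k j t ≤ ν j ↔ t ≤ b j) := fun j h1 h2 =>
        Set.ext_iff.1 (hb j h1 h2) t
      exact ⟨fun h => (hiff j₀ hj₀'.1 hj₀'.2).1 (h j₀ hj₀'.1 hj₀'.2), fun h j h1 h2 =>
        (hiff j h1 h2).2 (le_trans h (hmin j (mem_Icc.2 ⟨h1, h2⟩)))⟩
    have hβk : β k = b j₀ := by rw [hβ k hk hkM, hSk, csSup_Iic]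
    exact ⟨b, hb, ⟨j₀, hj₀'.1, hj₀'.2, hβk⟩, fun j h1 h2 =>
      hβk ▸ hmin j (mem_Icc.2 ⟨h1, h2⟩)⟩
  have hSIic : ∀ k, 1 ≤ k → k ≤ M → α k ∈ S k → S k = Set.Iic (β k) := by
    intro k hk hkM hαk
    obtain ⟨b, hb, ⟨j₀, h1, h2, hj₀⟩, hmin⟩ := hhalf k hk hkM hαk
    rw [hS]
    ext t
    have hiff : ∀ j, 1 ≤ j → j ≤ k → (f k j t ≤ ν j ↔ t ≤ b j) := fun j h1 h2 =>
      Set.ext_iff.1 (hb j h1 h2) t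
    exact ⟨fun h => hj₀ ▸ (hiff j₀ h1 h2).1 (h j₀ h1 h2), fun h j h1 h2 =>
      (hiff j h1 h2).2 (le_trans h (hmin j h1 h2))⟩
  have hstep : ∀ k j, j ≤ k → k < M → f k j (β (k + 1)) = f (k + 1) j (β (k + 1)) := by
    intro k j hjk hkM
    rw [hf, hf, ← Ico_add_one_right_eq_Icc (k + 1) M, sum_eq_sum_Ico_succ_bot (by omega),
      Ico_add_one_right_eq_Icc, sum_Icc_succ_top (by omega)]
    ring
  have hαS : ∀ k, 1 ≤ k → k ≤ M → α k ∈ S k := by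
    intro k hk hkM
    induction hkM using Nat.decreasingInduction with
    | self =>
      rw [hS]
      intro j h1 h2
      rw [hfα M j h1 le_rfl, Icc_eq_empty (by omega), sum_empty]
      exact hνnonneg j h1
    | of_succ k hkM ih =>
      have hmem : β (k + 1) ∈ S (k + 1) := by
        rw [hSIic (k + 1) (by omega) hkM (ih (by omega))]
        exact Set.mem_Iic.2 le_rfl
      rw [hS] at hmem ⊢
      intro j h1 h2
      rw [hfα k j h1 hkM.le]
      have := hmem j h1 (by omega)
      rw [← hstep k j h2 hkM, hf] at this
      have h0 : 0 ≤ ∑ m ∈ Icc j k, max (β (k + 1) - α (m - j + 1)) 0 :=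
        sum_nonneg fun m _ => le_max_right _ _
      linarith
  have hβmem : ∀ k, 1 ≤ k → k ≤ M → ∀ j, 1 ≤ j → j ≤ k → f k j (β k) ≤ ν j := by
    intro k hk hkM
    have hmem : β k ∈ S k := by
      rw [hSIic k hk hkM (hαS k hk hkM)]
      exact Set.mem_Iic.2 le_rfl
    rwa [hS] at hmem
  have hle : ∀ k, 1 ≤ k → k ≤ M → ∀ t, (∀ j, 1 ≤ j → j ≤ k → f k j t ≤ ν j) → t ≤ β k := by
    intro k hk hkM t ht
    have hmem : t ∈ S k := by rw [hS]; exact ht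
    rw [hSIic k hk hkM (hαS k hk hkM)] at hmem
    exact hmem
  have hβanti : ∀ k, 1 ≤ k → k < M → β (k + 1) ≤ β k := fun k hk hkM =>
    hle k hk hkM.le _ fun j h1 h2 => by
      rw [hstep k j h2 hkM]
      exact hβmem (k + 1) (by omega) hkM j h1 (by omega)
  have hαβ : ∀ k, 1 ≤ k → k ≤ M → α k ≤ β k := fun k hk hkM => by
    have hmem := hαS k hk hkM
    rw [hSIic k hk hkM hmem] at hmem
    exact hmem
  have htailf : ∀ p < M, f (p + 1) (p + 1) (β (p + 1)) =
      ∑ m ∈ Icc (p + 1) M, max (β m - α (m - p)) 0 := by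
    intro p hp
    have hsub : ∀ m ∈ Icc (p + 1 + 1) M,
        max (β m - α (m - (p + 1) + 1)) 0 = max (β m - α (m - p)) 0 := fun m hm => by
      have := mem_Icc.1 hm
      rw [show m - (p + 1) + 1 = m - p by omega]
    rw [hf, sum_congr rfl hsub, ← Ico_add_one_right_eq_Icc (p + 1) M,
      sum_eq_sum_Ico_succ_bot (by omega), Ico_add_one_right_eq_Icc]
    simp
  refine ⟨fun k hk hkM => hhalf k hk hkM (hαS k hk hkM), hβanti, hαβ,
    isCompletion_of_tail_sums hMN hα hμ
      ⟨fun k hk hkM => (hα.1 k hk hkM).trans (hαβ k hk hkM), hβanti⟩ hαβ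
      (fun p hp => ?_) ?_⟩
  · rw [← htailf p hp, ← hν]
    exact hβmem (p + 1) (by omega) hp (p + 1) (by omega) le_rfl
  · have htail := htailf 0 hM
    simp only [zero_add, Nat.sub_zero] at htail
    rw [← htail, ← hν]
    refine le_antisymm (hβmem 1 le_rfl hM 1 le_rfl le_rfl) ?_
    have hC := hβmem 1 le_rfl hM 1 le_rfl le_rfl |>.trans' (hmono 1 1 (hαβ 1 le_rfl hM))
    rw [hfα 1 1 le_rfl hM] at hC
    have hattained : f 1 1 (α 1 + (ν 1 - f 1 1 (α 1))) = ν 1 := by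
      rw [hfα 1 1 le_rfl hM, hf]
      simp only [Icc_self, sum_singleton, Nat.sub_self, zero_add, add_sub_cancel_left]
      rw [max_eq_left (sub_nonneg.2 hC)]
      ring
    refine hattained.symm.le.trans (hmono 1 1 (hle 1 le_rfl hM _ fun j h1 h2 => ?_))
    obtain rfl : j = 1 := by omega
    exact hattained.le
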